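/- Dominating pair of datasets for the without-replacement subsampled Gaussian mechanism under the remove relation: let σ > 0, let n, b be integers with 1 ≤ b ≤ n−1, and set γ := b/n. For every tuple D ∈ [−1,1]^n and every D' ∈ [−1,1]^{n−1} obtained from D by deleting one entry, and every α ≥ 0, H_α(M_{n,b}(D) ‖ M_{n−1,b}(D')) ≤ H_α((1−γ)·N(−b,σ²) + γ·N(2−b,σ²) ‖ N(−b,σ²)). Moreover this bound is realized by D = (−1,…,−1,1) of length n and D' = (−1,…,−1) of length n−1. -/

import Mathlib

open MeasureTheory ProbabilityTheory
open scoped ENNReal NNReal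

/-- Hockey-stick divergence: `H_α(P ‖ Q) = sup_{E measurable} (P(E) − α·Q(E))`. -/
noncomputable def hsDiv {X : Type*} [MeasurableSpace X] (α : ℝ) (P Q : Measure X) : ℝ :=
  ⨆ E : {E : Set X // MeasurableSet E}, ((P E).toReal - α * (Q E).toReal)

/-- The without-replacement subsampled Gaussian mechanism:
`M_{m,b}(x) = binom(m,b)⁻¹ ∑_{S ⊆ [m], |S| = b} N(∑_{i∈S} x_i, σ²)`. -/
noncomputable def worGauss (σ : ℝ) (b : ℕ) {m : ℕ} (x : Fin m → ℝ) : Measure ℝ :=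
  ((m.choose b : ℝ≥0∞))⁻¹ •
    ∑ S ∈ Finset.powersetCard b (Finset.univ : Finset (Fin m)),
      gaussianReal (∑ i ∈ S, x i) ⟨σ ^ 2, sq_nonneg σ⟩

lemma le_hsDiv {X : Type*} [MeasurableSpace X] {α : ℝ} (hα : 0 ≤ α) (P Q : Measure X)
    [IsFiniteMeasure P] {E : Set X} (hE : MeasurableSet E) :
    P.real E - α * Q.real E ≤ hsDiv α P Q := by
  have hbdd : BddAbove (Set.range fun E : {E : Set X // MeasurableSet E} ↦
      (P E).toReal - α * (Q E).toReal) := by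
    refine ⟨P.real Set.univ, ?_⟩
    rintro _ ⟨F, rfl⟩
    have hP : (P F).toReal ≤ P.real Set.univ := measureReal_mono (Set.subset_univ _)
    have hQ : 0 ≤ α * (Q F).toReal := mul_nonneg hα ENNReal.toReal_nonneg
    dsimp only
    linarith
  exact le_ciSup hbdd ⟨E, hE⟩

lemma hsDiv_le {X : Type*} [MeasurableSpace X] {α c : ℝ} {P Q : Measure X}
    (h : ∀ E, MeasurableSet E → P.real E - α * Q.real E ≤ c) : hsDiv α P Q ≤ c :=
  haveI : Nonempty {E : Set X // MeasurableSet E} := ⟨⟨∅, .empty⟩⟩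
  ciSup_le fun E ↦ h E E.2

/-- Data processing for a deterministic post-processing. -/
lemma hsDiv_map_le {X Y : Type*} [MeasurableSpace X] [MeasurableSpace Y] {α : ℝ} (hα : 0 ≤ α)
    (P Q : Measure X) [IsFiniteMeasure P] {f : X → Y} (hf : Measurable f) :
    hsDiv α (P.map f) (Q.map f) ≤ hsDiv α P Q :=
  hsDiv_le fun E hE ↦ by
    rw [map_measureReal_apply hf hE, map_measureReal_apply hf hE]
    exact le_hsDiv hα P Q (hf hE)

/-- Adjoining independent randomness does not increase the divergence. -/
lemma hsDiv_prod_le {X Y : Type*} [MeasurableSpace X] [MeasurableSpace Y] {α : ℝ} (hα : 0 ≤ α)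
    (P Q : Measure X) [IsFiniteMeasure P] [IsFiniteMeasure Q] (ν : Measure Y)
    [IsProbabilityMeasure ν] : hsDiv α (P.prod ν) (Q.prod ν) ≤ hsDiv α P Q := by
  refine hsDiv_le fun E hE ↦ ?_
  have key (μ : Measure X) [IsFiniteMeasure μ] :
      Integrable (fun y ↦ μ.real ((fun x ↦ (x, y)) ⁻¹' E)) ν ∧
        (μ.prod ν).real E = ∫ y, μ.real ((fun x ↦ (x, y)) ⁻¹' E) ∂ν := by
    have hm : Measurable fun y ↦ μ ((fun x ↦ (x, y)) ⁻¹' E) := measurable_measure_prodMk_right hE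
    constructor
    · refine .of_bound (C := μ.real Set.univ) hm.ennreal_toReal.aestronglyMeasurable
        (.of_forall fun y ↦ ?_)
      rw [Real.norm_of_nonneg measureReal_nonneg]
      exact measureReal_mono (Set.subset_univ _)
    · simp only [measureReal_def]
      rw [Measure.prod_apply_symm hE,
        integral_toReal hm.aemeasurable (.of_forall fun y ↦ measure_lt_top _ _)]
  rw [(key P).2, (key Q).2, ← integral_const_mul,
    ← integral_sub (key P).1 ((key Q).1.const_mul α)]
  calc _ ≤ ∫ _, hsDiv α P Q ∂ν :=
        integral_mono ((key P).1.sub ((key Q).1.const_mul α)) (integrable_const _)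
          fun y ↦ le_hsDiv hα P Q (measurable_prodMk_right hE)
    _ = hsDiv α P Q := by simp

lemma hsDiv_conv_le {α : ℝ} (hα : 0 ≤ α) (P Q ν : Measure ℝ) [IsFiniteMeasure P]
    [IsFiniteMeasure Q] [IsProbabilityMeasure ν] :
    hsDiv α (P.conv ν) (Q.conv ν) ≤ hsDiv α P Q :=
  (hsDiv_map_le hα (P.prod ν) (Q.prod ν) measurable_add).trans (hsDiv_prod_le hα P Q ν)

/-- Contracting two equal-variance Gaussians and adding noise to restore the variance turns
`N(s, v)` into `N(c s + t, v)`. -/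
lemma gaussianReal_map_conv {c : ℝ} (hc : c ^ 2 ≤ 1) (s t : ℝ) (v : ℝ≥0) :
    ((gaussianReal s v).map (c * ·)).conv
        (gaussianReal t (.mk (1 - c ^ 2) (sub_nonneg.2 hc) * v)) = gaussianReal (c * s + t) v := by
  rw [gaussianReal_map_const_mul, gaussianReal_conv_gaussianReal]
  congr 1
  rw [← add_mul]
  convert one_mul v
  ext
  simp

/-- The divergence of a two-component Gaussian mixture from its first component is monotone in the
distance between the component means. -/
lemma hsDiv_gaussianReal_mixture_le {α : ℝ} (hα : 0 ≤ α) (p q : ℝ) (v : ℝ≥0)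
    (s d u : ℝ) {c : ℝ} (hc : c ^ 2 ≤ 1) :
    hsDiv α (ENNReal.ofReal p • gaussianReal u v + ENNReal.ofReal q • gaussianReal (u + c * d) v)
        (gaussianReal u v) ≤
      hsDiv α (ENNReal.ofReal p • gaussianReal s v + ENNReal.ofReal q • gaussianReal (s + d) v)
        (gaussianReal s v) := by
  have hfin (r t : ℝ) : IsFiniteMeasure (ENNReal.ofReal r • gaussianReal t v) :=
    Measure.smul_finite _ ENNReal.ofReal_ne_top
  have hmeas : Measurable fun x : ℝ ↦ c * x := measurable_const_mul c
  set ν := gaussianReal (u - c * s) (.mk (1 - c ^ 2) (sub_nonneg.2 hc) * v) with hν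
  have h₁ : ((gaussianReal s v).map (c * ·)).conv ν = gaussianReal u v := by
    rw [hν, gaussianReal_map_conv hc]
    congr 1
    ring
  have h₂ : ((gaussianReal (s + d) v).map (c * ·)).conv ν = gaussianReal (u + c * d) v := by
    rw [hν, gaussianReal_map_conv hc]
    congr 1
    ring
  rw [← h₁, ← h₂, ← Measure.conv_smul_left, ← Measure.conv_smul_left, ← Measure.map_smul,
    ← Measure.map_smul, ← Measure.add_conv, ← Measure.map_add _ _ hmeas]
  exact (hsDiv_conv_le hα _ _ ν).trans (hsDiv_map_le hα _ _ hmeas)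

/-- Splitting a sum over the `(k + 1)`-subsets of `Fin (m + 1)` according to whether they contain
a given index. -/
lemma sum_powersetCard_succAbove {M : Type*} [AddCommMonoid M] (m k : ℕ) (i : Fin (m + 1))
    (x : Fin (m + 1) → ℝ) (f : ℝ → M) :
    ∑ S ∈ Finset.powersetCard (k + 1) Finset.univ, f (∑ j ∈ S, x j) =
      ∑ T ∈ Finset.powersetCard (k + 1) Finset.univ, f (∑ j ∈ T, x (i.succAbove j)) +
        ∑ R ∈ Finset.powersetCard k Finset.univ, f (∑ j ∈ R, x (i.succAbove j) + x i) := by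
  have hi (R : Finset (Fin m)) : i ∉ R.map i.succAboveEmb := by simp [Fin.succAbove_ne]
  rw [Fin.univ_succAbove m i, Finset.cons_eq_insert, Finset.powersetCard_succ_insert (hi _),
    Finset.powersetCard_map, Finset.powersetCard_map, Finset.sum_union, Finset.sum_map,
    Finset.sum_image, Finset.sum_map]
  · simp [Finset.sum_insert, Fin.succAbove_ne, add_comm]
  · intro A hA B hB hAB
    simp only [Finset.coe_map, Set.mem_image] at hA hB
    obtain ⟨A', -, rfl⟩ := hA
    obtain ⟨B', -, rfl⟩ := hB
    have := congrArg (fun s ↦ s.erase i) hAB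
    simpa [Finset.erase_insert, Fin.succAbove_ne] using this
  · rw [Finset.disjoint_left]
    intro A hA hA'
    obtain ⟨A', -, rfl⟩ := Finset.mem_map.1 hA
    obtain ⟨B, -, hB⟩ := Finset.mem_image.1 hA'
    have hB' : insert i B = A'.map i.succAboveEmb := hB
    exact hi A' (hB' ▸ Finset.mem_insert_self i B)

/-- Double counting of pairs consisting of a `k`-subset and a point outside of it. -/
lemma sum_powersetCard_compl {ι : Type*} [Fintype ι] [DecidableEq ι] (k : ℕ)
    (f : Finset ι → ℝ) :
    ∑ R ∈ Finset.powersetCard k Finset.univ, ∑ j ∈ Rᶜ, f (insert j R) =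
      (k + 1) * ∑ T ∈ Finset.powersetCard (k + 1) Finset.univ, f T := by
  have h : ∑ T ∈ Finset.powersetCard (k + 1) (Finset.univ : Finset ι), ∑ _j ∈ T, f T =
      (k + 1) * ∑ T ∈ Finset.powersetCard (k + 1) Finset.univ, f T := by
    rw [Finset.mul_sum]
    refine Finset.sum_congr rfl fun T hT ↦ ?_
    simp [(Finset.mem_powersetCard.1 hT).2]
  rw [← h, Finset.sum_sigma', Finset.sum_sigma']
  refine Finset.sum_bij' (fun a _ ↦ ⟨insert a.2 a.1, a.2⟩) (fun a _ ↦ ⟨a.1.erase a.2, a.2⟩)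
    ?_ ?_ ?_ ?_ ?_
  · rintro ⟨R, j⟩ h
    simp only [Finset.mem_sigma, Finset.mem_powersetCard, Finset.mem_compl] at h ⊢
    simp [h.2, h.1.2]
  · rintro ⟨R, j⟩ h
    simp only [Finset.mem_sigma, Finset.mem_powersetCard, Finset.mem_compl] at h ⊢
    simp [h.2, h.1.2]
  · rintro ⟨R, j⟩ h
    simp only [Finset.mem_sigma, Finset.mem_powersetCard, Finset.mem_compl] at h ⊢
    simp [h.2]
  · rintro ⟨R, j⟩ h
    simp only [Finset.mem_sigma, Finset.mem_powersetCard] at h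
    simp [Finset.insert_erase h.2]
  · rintro ⟨R, j⟩ h
    rfl

lemma worGauss_real (σ : ℝ) (b : ℕ) {m : ℕ} (x : Fin m → ℝ) (E : Set ℝ) :
    (worGauss σ b x).real E = (m.choose b : ℝ)⁻¹ *
      ∑ S ∈ Finset.powersetCard b Finset.univ,
        (gaussianReal (∑ i ∈ S, x i) ⟨σ ^ 2, sq_nonneg σ⟩).real E := by
  have hfin (t : ℝ) : IsFiniteMeasure (gaussianReal t ⟨σ ^ 2, sq_nonneg σ⟩) :=
    inferInstanceAs (IsFiniteMeasure (gaussianReal t (.mk (σ ^ 2) (sq_nonneg σ))))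
  rw [worGauss, measureReal_ennreal_smul_apply, measureReal_def, Measure.finsetSum_apply,
    ENNReal.toReal_sum fun _ _ ↦ measure_ne_top _ _]
  simp [measureReal_def]

lemma inv_choose_succ_mul_choose_succ {m k : ℕ} (h : k + 1 ≤ m) :
    ((m + 1).choose (k + 1) : ℝ)⁻¹ * m.choose (k + 1) = 1 - (k + 1) / (m + 1) := by
  have h₀ : ((m + 1).choose (k + 1) : ℝ) ≠ 0 := by
    exact_mod_cast (Nat.choose_pos (by omega)).ne'
  have h₁ : ((m : ℝ) + 1) * m.choose k = (m + 1).choose (k + 1) * (k + 1) := by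
    exact_mod_cast Nat.add_one_mul_choose_eq m k
  have h₂ : ((m + 1).choose (k + 1) : ℝ) = m.choose k + m.choose (k + 1) := by
    exact_mod_cast Nat.choose_succ_succ m k
  have h₃ : (m : ℝ) + 1 ≠ 0 := by positivity
  field_simp
  linear_combination -h₁ - (m + 1) * h₂

lemma inv_choose_succ_mul_choose {m k : ℕ} (h : k + 1 ≤ m) :
    ((m + 1).choose (k + 1) : ℝ)⁻¹ * m.choose k = (k + 1) / (m + 1) := by
  have h₀ : ((m + 1).choose (k + 1) : ℝ) ≠ 0 := by
    exact_mod_cast (Nat.choose_pos (by omega)).ne'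
  have h₁ : ((m : ℝ) + 1) * m.choose k = (m + 1).choose (k + 1) * (k + 1) := by
    exact_mod_cast Nat.add_one_mul_choose_eq m k
  have h₃ : (m : ℝ) + 1 ≠ 0 := by positivity
  field_simp
  linear_combination h₁

/-- Averaging over `(k + 1)`-subsets and over `k`-subsets can be coupled so that the former
arises from the latter by adding one point. -/
lemma mixture_average_le {m k : ℕ} (h : k + 1 ≤ m) (x : Fin m → ℝ) (y p q α c : ℝ) (g : ℝ → ℝ)
    (hg : ∀ u, ∀ j, p * g (u + x j) + q * g (u + y) - α * g (u + x j) ≤ c) :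
    p * ((m.choose (k + 1) : ℝ)⁻¹ * ∑ T ∈ Finset.powersetCard (k + 1) Finset.univ,
          g (∑ j ∈ T, x j)) +
        q * ((m.choose k : ℝ)⁻¹ * ∑ R ∈ Finset.powersetCard k Finset.univ,
          g (∑ j ∈ R, x j + y)) -
        α * ((m.choose (k + 1) : ℝ)⁻¹ * ∑ T ∈ Finset.powersetCard (k + 1) Finset.univ,
          g (∑ j ∈ T, x j)) ≤ c := by
  have hcard {R : Finset (Fin m)} (hR : R ∈ Finset.powersetCard k Finset.univ) :
      ((Rᶜ).card : ℝ) = m - k := by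
    rw [Finset.card_compl, (Finset.mem_powersetCard.1 hR).2, Fintype.card_fin,
      Nat.cast_sub (by omega)]
  have hsum : ∑ R ∈ Finset.powersetCard k (Finset.univ : Finset (Fin m)), ∑ j ∈ Rᶜ,
      (p * g (∑ i ∈ R, x i + x j) + q * g (∑ i ∈ R, x i + y) - α * g (∑ i ∈ R, x i + x j)) ≤
      m.choose k * ((m - k) * c) := by
    calc _ ≤ ∑ R ∈ Finset.powersetCard k (Finset.univ : Finset (Fin m)), (m - k) * c := by
          refine Finset.sum_le_sum fun R hR ↦ ?_
          rw [← hcard hR, ← nsmul_eq_mul]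
          exact Finset.sum_le_card_nsmul _ _ _ fun j _ ↦ hg _ j
      _ = _ := by simp
  have h₁ : ∑ R ∈ Finset.powersetCard k (Finset.univ : Finset (Fin m)), ∑ j ∈ Rᶜ,
      g (∑ i ∈ R, x i + x j) =
      (k + 1) * ∑ T ∈ Finset.powersetCard (k + 1) Finset.univ, g (∑ j ∈ T, x j) := by
    rw [← sum_powersetCard_compl k fun T ↦ g (∑ j ∈ T, x j)]
    refine Finset.sum_congr rfl fun R _ ↦ Finset.sum_congr rfl fun j hj ↦ ?_
    rw [Finset.sum_insert (Finset.mem_compl.1 hj), add_comm]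
  have h₂ : ∑ R ∈ Finset.powersetCard k (Finset.univ : Finset (Fin m)), ∑ _j ∈ Rᶜ,
      g (∑ i ∈ R, x i + y) =
      (m - k) * ∑ R ∈ Finset.powersetCard k Finset.univ, g (∑ j ∈ R, x j + y) := by
    rw [Finset.mul_sum]
    refine Finset.sum_congr rfl fun R hR ↦ ?_
    rw [Finset.sum_const, nsmul_eq_mul, hcard hR]
  simp only [Finset.sum_sub_distrib, Finset.sum_add_distrib, ← Finset.mul_sum, h₁, h₂] at hsum
  have hN : (m.choose (k + 1) : ℝ) * (k + 1) = m.choose k * (m - k) := by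
    have := Nat.choose_succ_right_eq m k
    rw [← Nat.cast_sub (by omega : k ≤ m)]
    exact_mod_cast this
  have hk : 0 < (m.choose k : ℝ) := by exact_mod_cast Nat.choose_pos (by omega)
  have hk' : 0 < (m.choose (k + 1) : ℝ) := by exact_mod_cast Nat.choose_pos h
  have hmk : 0 < (m : ℝ) - k := by
    rw [← Nat.cast_sub (by omega : k ≤ m)]
    exact_mod_cast (by omega : 0 < m - k)
  have hinv : (m.choose (k + 1) : ℝ)⁻¹ = (k + 1) / (m.choose k * (m - k)) := by
    rw [← hN]
    field_simp
  rw [hinv]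
  refine le_of_mul_le_mul_left (le_trans (le_of_eq ?_) (hsum.trans_eq (mul_assoc _ _ _).symm))
    (mul_pos hk hmk)
  field_simp

/-- Dominating pair of datasets for the without-replacement subsampled Gaussian mechanism
under the remove relation (with `n = m + 1`, `1 ≤ b ≤ m`, `γ = b/n`): for datasets with
entries in `[−1,1]` where `D' ∈ [−1,1]^{n−1}` is obtained from `D ∈ [−1,1]^n` by deleting one
entry, `H_α(M_{n,b}(D) ‖ M_{n−1,b}(D')) ≤ H_α((1−γ)N(−b,σ²) + γN(2−b,σ²) ‖ N(−b,σ²))` for all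
`α ≥ 0`, and the bound is realized by `D = (−1,…,−1,1)`, `D' = (−1,…,−1)`. -/
theorem worGauss_dominating_pair_remove (σ : ℝ) (hσ : 0 < σ) (m b : ℕ) (hb1 : 1 ≤ b)
    (hbm : b ≤ m) (γ : ℝ) (hγ : γ = (b : ℝ) / (m + 1)) :
    (∀ (D : Fin (m + 1) → ℝ) (D' : Fin m → ℝ),
      (∀ j, D j ∈ Set.Icc (-1 : ℝ) 1) → (∀ j, D' j ∈ Set.Icc (-1 : ℝ) 1) →
      (∃ i : Fin (m + 1), ∀ j : Fin m, D' j = D (i.succAbove j)) →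
      ∀ α : ℝ, 0 ≤ α →
        hsDiv α (worGauss σ b D) (worGauss σ b D') ≤
          hsDiv α
            (ENNReal.ofReal (1 - γ) • gaussianReal (-(b : ℝ)) ⟨σ ^ 2, sq_nonneg σ⟩ +
              ENNReal.ofReal γ • gaussianReal (2 - (b : ℝ)) ⟨σ ^ 2, sq_nonneg σ⟩)
            (gaussianReal (-(b : ℝ)) ⟨σ ^ 2, sq_nonneg σ⟩)) ∧
    worGauss σ b (Fin.snoc (fun _ : Fin m => (-1 : ℝ)) 1) =
      ENNReal.ofReal (1 - γ) • gaussianReal (-(b : ℝ)) ⟨σ ^ 2, sq_nonneg σ⟩ +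
        ENNReal.ofReal γ • gaussianReal (2 - (b : ℝ)) ⟨σ ^ 2, sq_nonneg σ⟩ ∧
    worGauss σ b (fun _ : Fin m => (-1 : ℝ)) = gaussianReal (-(b : ℝ)) ⟨σ ^ 2, sq_nonneg σ⟩ := by
  obtain ⟨k, rfl⟩ : ∃ k, b = k + 1 := ⟨b - 1, by omega⟩
  have hγ' : γ = ((k : ℝ) + 1) / (m + 1) := by rw [hγ]; push_cast; rfl
  have hγ0 : 0 ≤ γ := by rw [hγ']; positivity
  have hγ1 : 0 ≤ 1 - γ := by
    rw [hγ', ← inv_choose_succ_mul_choose_succ hbm]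
    positivity
  have hC : ((m + 1).choose (k + 1) : ℝ) ≠ 0 := by
    exact_mod_cast (Nat.choose_pos (by omega)).ne'
  have hk : (m.choose k : ℝ) ≠ 0 := by exact_mod_cast (Nat.choose_pos (by omega)).ne'
  have hk' : (m.choose (k + 1) : ℝ) ≠ 0 := by exact_mod_cast (Nat.choose_pos hbm).ne'
  have hp := inv_choose_succ_mul_choose_succ hbm
  have hq := inv_choose_succ_mul_choose hbm
  rw [← hγ'] at hp hq
  have hconst (l : ℕ) (T : Finset (Fin m)) (hT : T ∈ Finset.powersetCard l Finset.univ) :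
      ∑ _j ∈ T, (-1 : ℝ) = -l := by
    simp [(Finset.mem_powersetCard.1 hT).2]
  refine ⟨?_, ?_, ?_⟩
  · rintro D D' hD hD' ⟨i, hi⟩ α hα
    refine hsDiv_le fun E hE ↦ ?_
    rw [worGauss_real, worGauss_real, sum_powersetCard_succAbove m k i D
      fun t ↦ (gaussianReal t ⟨σ ^ 2, sq_nonneg σ⟩).real E]
    simp only [← hi]
    set v : ℝ≥0 := ⟨σ ^ 2, sq_nonneg σ⟩
    refine le_trans (le_of_eq ?_) (mixture_average_le hbm D' (D i) (1 - γ) γ α _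
      (fun t ↦ (gaussianReal t v).real E) fun u j ↦ ?_)
    · rw [← hp, ← hq]
      field_simp
    · have hc : ((D i - D' j) / 2) ^ 2 ≤ 1 := by
        rw [sq_le_one_iff_abs_le_one, abs_le]
        constructor <;> linarith [(hD i).1, (hD i).2, (hD' j).1, (hD' j).2]
      have hfin (r t : ℝ) : IsFiniteMeasure (ENNReal.ofReal r • gaussianReal t v) :=
        Measure.smul_finite _ ENNReal.ofReal_ne_top
      have key := (le_hsDiv hα _ _ hE).trans (hsDiv_gaussianReal_mixture_le hα (1 - γ) γ v
        (-((k + 1 : ℕ) : ℝ)) 2 (u + D' j) hc)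
      rw [measureReal_add_apply, measureReal_ennreal_smul_apply, measureReal_ennreal_smul_apply,
        ENNReal.toReal_ofReal hγ0, ENNReal.toReal_ofReal hγ1] at key
      rwa [show u + D' j + (D i - D' j) / 2 * 2 = u + D i by ring,
        show -((k + 1 : ℕ) : ℝ) + 2 = 2 - ((k + 1 : ℕ) : ℝ) by ring] at key
  · rw [worGauss, sum_powersetCard_succAbove m k (Fin.last m) _
      fun t ↦ gaussianReal t ⟨σ ^ 2, sq_nonneg σ⟩]
    simp only [Fin.succAbove_last, Fin.snoc_castSucc, Fin.snoc_last]
    rw [Finset.sum_congr rfl fun T hT ↦ by rw [hconst _ T hT],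
      Finset.sum_congr (s₁ := Finset.powersetCard k _) rfl fun T hT ↦ by rw [hconst _ T hT]]
    have hmean : -(k : ℝ) + 1 = 2 - ((k + 1 : ℕ) : ℝ) := by push_cast; ring
    rw [Finset.sum_const, Finset.sum_const, Finset.card_powersetCard, Finset.card_powersetCard,
      Finset.card_univ, Fintype.card_fin, hmean, ← hp, ← hq, smul_add]
    have hcoe (a : ℕ) : ENNReal.ofReal (((m + 1).choose (k + 1) : ℝ)⁻¹ * a) =
        ((m + 1).choose (k + 1) : ℝ≥0∞)⁻¹ * a := by
      rw [ENNReal.ofReal_mul (by positivity), ENNReal.ofReal_inv_of_pos (by positivity),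
        ENNReal.ofReal_natCast, ENNReal.ofReal_natCast]
    rw [hcoe, hcoe, mul_smul, mul_smul, Nat.cast_smul_eq_nsmul, Nat.cast_smul_eq_nsmul]
  · rw [worGauss, Finset.sum_congr rfl fun T hT ↦ by rw [hconst _ T hT], Finset.sum_const,
      Finset.card_powersetCard, Finset.card_univ, Fintype.card_fin,
      ← Nat.cast_smul_eq_nsmul ℝ≥0∞, smul_smul, ENNReal.inv_mul_cancel, one_smul]
    · exact_mod_cast hk'
    · exact ENNReal.natCast_ne_top _
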